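/- Let (γ_n) be a sequence with γ_n > −1/2 such that γ_n/n → ∞ as n → ∞. For n ≥ 2, let σ_n^+ denote the largest positive zero, ρ_n^+ the smallest positive zero, σ_n^- the largest negative zero, and ρ_n^- the smallest negative zero of H_n^{(γ_n)}. Then lim_{n→∞} ((σ_n^+)² − γ_n)/√(n·γ_n) = lim_{n→∞} ((ρ_n^-)² − γ_n)/√(n·γ_n) = √2 and lim_{n→∞} ((ρ_n^+)² − γ_n)/√(n·γ_n) = lim_{n→∞} ((σ_n^-)² − γ_n)/√(n·γ_n) = −√2. Moreover, the closure of the set ⋃_{n≥1} { (x² − γ_n)/√(n·γ_n) : H_n^{(γ_n)}(x) = 0, x ≠ 0 } contains the interval [−√2, √2]. -/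

import Mathlib

open Filter Topology

/-- Generalized binomial coefficient C(t, m) = t(t-1)⋯(t-m+1)/m! for real t. -/
noncomputable def genBinom (t : ℝ) (m : ℕ) : ℝ :=
  (∏ i ∈ Finset.range m, (t - (i : ℝ))) / (Nat.factorial m)

/-- Laguerre polynomial L_n^{(α)}. -/
noncomputable def laguerreL (n : ℕ) (α : ℝ) (x : ℝ) : ℝ :=
  ∑ k ∈ Finset.range (n + 1),
    (-1) ^ k * genBinom ((n : ℝ) + α) (n - k) * x ^ k / (Nat.factorial k)

/-- Generalized Hermite polynomial H_n^{(γ)}: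
`H_{2m}^{(γ)}(x) = (-1)^m 2^{2m} m! L_m^{(γ-1/2)}(x²)` and
`H_{2m+1}^{(γ)}(x) = (-1)^m 2^{2m+1} m! x L_m^{(γ-1/2)}(x²)`. -/
noncomputable def hermiteH (n : ℕ) (γ : ℝ) (x : ℝ) : ℝ :=
  if n % 2 = 0 then
    (-1) ^ (n / 2) * 2 ^ n * (Nat.factorial (n / 2)) * laguerreL (n / 2) (γ - 1/2) (x ^ 2)
  else
    (-1) ^ (n / 2) * 2 ^ n * (Nat.factorial (n / 2)) * x * laguerreL (n / 2) (γ - 1/2) (x ^ 2)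

/-- Number of zeros of H_n^{(γ)} that are ≤ ξ. -/
noncomputable def hermiteM (n : ℕ) (γ ξ : ℝ) : ℕ :=
  {x : ℝ | hermiteH n γ x = 0 ∧ x ≤ ξ}.ncard

/-- The rising factorial `(α + 1)(α + 2)⋯(α + k)`. -/
noncomputable def risingProd (α : ℝ) (k : ℕ) : ℝ :=
  ∏ i ∈ Finset.range k, (α + 1 + i)

lemma risingProd_succ (α : ℝ) (k : ℕ) :
    risingProd α (k + 1) = risingProd α k * (α + 1 + k) :=
  Finset.prod_range_succ _ _

lemma risingProd_pos {α : ℝ} (hα : -1 < α) (k : ℕ) : 0 < risingProd α k :=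
  Finset.prod_pos fun i _ => by
    have : (0 : ℝ) ≤ i := i.cast_nonneg
    linarith

/-- The Laguerre polynomial normalized to take the value `1` at `0`, that is `₁F₁(-n; α + 1; x)`. -/
noncomputable def kummerPoly (α : ℝ) (n : ℕ) : Polynomial ℝ :=
  ∑ j ∈ Finset.range (n + 1), Polynomial.monomial j ((-1) ^ j * (n.choose j) / risingProd α j)

lemma kummerPoly_coeff (α : ℝ) (n j : ℕ) :
    (kummerPoly α n).coeff j = (-1) ^ j * (n.choose j) / risingProd α j := by
  simp only [kummerPoly, Polynomial.finsetSum_coeff, Polynomial.coeff_monomial,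
    Finset.sum_ite_eq', Finset.mem_range]
  split_ifs with h
  · rfl
  · simp [Nat.choose_eq_zero_of_lt (show n < j by omega)]

lemma genBinom_mul_risingProd (α : ℝ) {n j : ℕ} (hj : j ≤ n) :
    genBinom ((n : ℝ) + α) (n - j) * (n - j).factorial * risingProd α j = risingProd α n := by
  obtain ⟨k, rfl⟩ := Nat.exists_eq_add_of_le hj
  have hk : (k.factorial : ℝ) ≠ 0 := by positivity
  rw [Nat.add_sub_cancel_left, genBinom, div_mul_cancel₀ _ hk, risingProd, risingProd,
    Finset.prod_range_add, mul_comm,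
    ← Finset.prod_range_reflect (fun i : ℕ => ((j + k : ℕ) : ℝ) + α - i)]
  congr 1
  refine Finset.prod_congr rfl fun i hi => ?_
  have hi' : i + 1 ≤ k := Finset.mem_range.mp hi
  have : ((k - 1 - i : ℕ) : ℝ) = k - 1 - i := by
    rw [Nat.sub_sub, Nat.cast_sub (by omega)]
    push_cast
    ring
  rw [this]
  push_cast
  ring

lemma laguerreL_eq {α : ℝ} (hα : -1 < α) (n : ℕ) (x : ℝ) :
    laguerreL n α x = risingProd α n / n.factorial * (kummerPoly α n).eval x := by
  rw [laguerreL, kummerPoly, Polynomial.eval_finsetSum, Finset.mul_sum]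
  refine Finset.sum_congr rfl fun j hj => ?_
  have hjn : j ≤ n := Nat.lt_succ_iff.mp (Finset.mem_range.mp hj)
  have h1 := genBinom_mul_risingProd α hjn
  have h2 : (n.choose j : ℝ) * j.factorial * (n - j).factorial = n.factorial :=
    mod_cast Nat.choose_mul_factorial_mul_factorial hjn
  have h3 := (risingProd_pos hα j).ne'
  have h4 : (n.factorial : ℝ) ≠ 0 := by positivity
  have h5 : (j.factorial : ℝ) ≠ 0 := by positivity
  rw [Polynomial.eval_monomial, ← h1, ← h2]
  rw [← h2] at h4
  have h6 : ((n - j).factorial : ℝ) ≠ 0 := by positivity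
  have h7 : (n.choose j : ℝ) ≠ 0 := fun h => h4 (by simp [h])
  field_simp

lemma laguerreL_eq_zero_iff {α : ℝ} (hα : -1 < α) (n : ℕ) (x : ℝ) :
    laguerreL n α x = 0 ↔ (kummerPoly α n).eval x = 0 := by
  have h1 := (risingProd_pos hα n).ne'
  have h4 : (n.factorial : ℝ) ≠ 0 := by positivity
  rw [laguerreL_eq hα, mul_eq_zero, or_iff_right (div_ne_zero h1 h4)]

lemma cast_choose_succ_mul (n i : ℕ) :
    (n.choose (i + 1) : ℝ) * (i + 1) = n.choose i * (n - i) := by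
  rcases le_or_gt i n with h | h
  · rw [← Nat.cast_sub h]
    exact_mod_cast Nat.choose_succ_right_eq n i
  · simp [Nat.choose_eq_zero_of_lt h, Nat.choose_eq_zero_of_lt (h.trans i.lt_succ_self)]

/-- The Kummer differential equation. -/
lemma kummerPoly_ode {α : ℝ} (hα : -1 < α) (n : ℕ) :
    Polynomial.X * (kummerPoly α n).derivative.derivative
      + (Polynomial.C (α + 1) - Polynomial.X) * (kummerPoly α n).derivative
      + Polynomial.C (n : ℝ) * kummerPoly α n = 0 := by
  ext j
  have key : ∀ i : ℕ, ((i : ℝ) + 1) * (α + 1 + i) * (kummerPoly α n).coeff (i + 1)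
      = (i - n) * (kummerPoly α n).coeff i := by
    intro i
    have h1 := (risingProd_pos hα i).ne'
    have h2 : α + 1 + i ≠ 0 := by
      have : (0 : ℝ) ≤ i := i.cast_nonneg
      linarith
    have h3 := cast_choose_succ_mul n i
    rw [kummerPoly_coeff, kummerPoly_coeff, risingProd_succ]
    field_simp
    rw [pow_succ]
    linear_combination (-(-1 : ℝ) ^ i) * h3
  have hk := key j
  rcases j with _ | j
  · simp only [sub_mul, Polynomial.coeff_add, Polynomial.coeff_sub, Polynomial.coeff_C_mul,
      Polynomial.coeff_X_mul_zero, Polynomial.coeff_derivative, Polynomial.coeff_zero]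
    push_cast at hk ⊢
    linear_combination hk
  · simp only [sub_mul, Polynomial.coeff_add, Polynomial.coeff_sub, Polynomial.coeff_C_mul,
      Polynomial.coeff_X_mul, Polynomial.coeff_derivative, Polynomial.coeff_zero]
    push_cast at hk ⊢
    linear_combination hk

/-- The three-term recurrence of the Laguerre polynomials. -/
lemma kummerPoly_recurrence {α : ℝ} (hα : -1 < α) (n : ℕ) :
    Polynomial.C (n + 2 + α) * kummerPoly α (n + 2)
      = (Polynomial.C (2 * n + 3 + α) - Polynomial.X) * kummerPoly α (n + 1)
        - Polynomial.C (n + 1 : ℝ) * kummerPoly α n := by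
  ext j
  rcases j with _ | j
  · simp only [sub_mul, Polynomial.coeff_sub, Polynomial.coeff_C_mul, kummerPoly_coeff,
      Polynomial.coeff_X_mul_zero]
    simp [risingProd]
    ring
  · simp only [sub_mul, Polynomial.coeff_sub, Polynomial.coeff_C_mul, kummerPoly_coeff,
      Polynomial.coeff_X_mul, risingProd_succ]
    have h1 := (risingProd_pos hα j).ne'
    have h2 : α + 1 + j ≠ 0 := by
      have : (0 : ℝ) ≤ j := j.cast_nonneg
      linarith
    have h3 : ((n + 2).choose (j + 1) : ℝ) = (n + 1).choose j + (n + 1).choose (j + 1) :=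
      mod_cast Nat.choose_succ_succ _ _
    have h4 : ((n + 1).choose (j + 1) : ℝ) = n.choose j + n.choose (j + 1) :=
      mod_cast Nat.choose_succ_succ _ _
    have h5 : ((n : ℝ) + 1) * n.choose j = (n + 1).choose (j + 1) * (j + 1) :=
      mod_cast Nat.add_one_mul_choose_eq n j
    field_simp
    rw [pow_succ, h3]
    have h6 := cast_choose_succ_mul (n + 1) j
    push_cast at h6
    linear_combination (-(-1 : ℝ) ^ j) * (-(n + 1) * h4 - h5 - h6)

/-- The interval containing all zeros, from the diagonal dominance of the recurrence. -/
lemma kummerPoly_eval_ne_zero {α R σ x : ℝ} (hα : -1 < α) (hR : 0 < R) (m : ℕ)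
    (hσ : σ ^ 2 = 1) (hRm : ∀ k : ℕ, k < m → k * (k + α) ≤ R ^ 2)
    (h : ∀ k : ℕ, k < m → 2 * R ≤ σ * (2 * k + 1 + α - x)) :
    (kummerPoly α m).eval x ≠ 0 := by
  set g : ℕ → ℝ := fun k => σ ^ k * (risingProd α k * (kummerPoly α k).eval x) with hg
  have g0 : g 0 = 1 := by simp [hg, risingProd, kummerPoly]
  have g1 : g 1 = σ * (1 + α - x) := by
    have : α + 1 ≠ 0 := by linarith
    have he : (kummerPoly α 1).eval x = 1 - x / (α + 1) := by
      simp [risingProd, kummerPoly, Finset.sum_range_succ]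
      ring
    simp only [hg, he, pow_one, risingProd_succ]
    simp only [risingProd, Finset.range_zero, Finset.prod_empty, Nat.cast_zero]
    field_simp
    ring
  have g2 : ∀ k, g (k + 2) = σ * (2 * (k + 1 : ℕ) + 1 + α - x) * g (k + 1)
      - (k + 1 : ℕ) * ((k + 1 : ℕ) + α) * g k := by
    intro k
    have hr := congrArg (Polynomial.eval x) (kummerPoly_recurrence hα k)
    simp only [Polynomial.eval_mul, Polynomial.eval_sub, Polynomial.eval_C,
      Polynomial.eval_X] at hr
    simp only [hg, risingProd_succ]
    push_cast
    rw [pow_succ, pow_succ]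
    linear_combination σ ^ k * σ ^ 2 * risingProd α k * (α + 1 + k) * hr
      - σ ^ k * risingProd α k * (α + 1 + k) * (k + 1) * (kummerPoly α k).eval x * hσ
  have main : ∀ k, k < m → 0 < g k ∧ R * g k ≤ g (k + 1) := by
    intro k
    induction k with
    | zero =>
      intro hk
      have := h 0 hk
      rw [g0, g1]
      push_cast at this
      constructor
      · norm_num
      · linarith [show σ * (2 * 0 + 1 + α - x) = σ * (1 + α - x) by ring]
    | succ k ih =>
      intro hk
      obtain ⟨hpos, hle⟩ := ih (by omega)
      have hpos' : 0 < g (k + 1) := (mul_pos hR hpos).trans_le hle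
      refine ⟨hpos', ?_⟩
      rw [g2]
      have e1 := mul_le_mul_of_nonneg_right (h (k + 1) hk) hpos'.le
      have e2 := mul_le_mul_of_nonneg_right (hRm (k + 1) hk) hpos.le
      have e3 := mul_le_mul_of_nonneg_left hle hR.le
      nlinarith
  have hgm : 0 < g m := by
    rcases m with _ | m
    · rw [g0]; norm_num
    · obtain ⟨h1, h2⟩ := main m (Nat.lt_succ_self m)
      exact (mul_pos hR h1).trans_le h2
  intro h0
  simp [hg, h0] at hgm

/-- A Riccati inequality `w' ≤ -(w² + c²)` has no solution on an interval of length `π / c`. -/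
lemma riccati_length_lt {w w' : ℝ → ℝ} {a b c : ℝ} (hab : a < b) (hc : 0 < c)
    (hw : ∀ x ∈ Set.Icc a b, HasDerivAt w (w' x) x)
    (hle : ∀ x ∈ Set.Icc a b, w' x ≤ -(w x ^ 2 + c ^ 2)) : c * (b - a) < Real.pi := by
  have hd : ∀ x ∈ Set.Icc a b, HasDerivAt (fun x => Real.arctan (w x / c))
      (1 / (1 + (w x / c) ^ 2) * (w' x / c)) x :=
    fun x hx => ((hw x hx).div_const c).arctan
  obtain ⟨ξ, hξ, he⟩ := exists_hasDerivAt_eq_slope _ _ hab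
    (fun x hx => (hd x hx).continuousAt.continuousWithinAt)
    (fun x hx => hd x (Set.Ioo_subset_Icc_self hx))
  have h1 : 1 / (1 + (w ξ / c) ^ 2) * (w' ξ / c) ≤ -c := by
    have hp : 0 < c ^ 2 + w ξ ^ 2 := by positivity
    have : 1 / (1 + (w ξ / c) ^ 2) * (w' ξ / c) = c * w' ξ / (c ^ 2 + w ξ ^ 2) := by
      field_simp
    rw [this, div_le_iff₀ hp]
    nlinarith [hle ξ (Set.Ioo_subset_Icc_self hξ)]
  rw [he, div_le_iff₀ (sub_pos.mpr hab)] at h1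
  linarith [Real.arctan_lt_pi_div_two (w a / c), Real.neg_pi_div_two_lt_arctan (w b / c)]

lemma exists_kummerPoly_eval_eq_zero {α a b c : ℝ} (hα : -1 < α) (m : ℕ) (ha : 0 < a)
    (hab : a < b) (hc : 0 < c) (hlen : Real.pi ≤ c * (b - a))
    (hQ : ∀ x ∈ Set.Icc a b,
      4 * c ^ 2 * x ^ 2 ≤ 4 * m * x - (α + 1 - x) ^ 2 + 2 * (α + 1)) :
    ∃ x ∈ Set.Icc a b, (kummerPoly α m).eval x = 0 := by
  by_contra! hne
  set p := kummerPoly α m with hp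
  refine absurd (riccati_length_lt hab hc
    (w := fun x => p.derivative.eval x / p.eval x + ((α + 1) / 2 * x⁻¹ - 1 / 2))
    (w' := fun x => (p.derivative.derivative.eval x * p.eval x
      - p.derivative.eval x * p.derivative.eval x) / p.eval x ^ 2
      + (α + 1) / 2 * (-(x ^ 2)⁻¹)) ?_ ?_) (not_lt.mpr hlen)
  · intro x hx
    have hx0 : x ≠ 0 := (ha.trans_le hx.1).ne'
    exact ((p.derivative.hasDerivAt x).div (p.hasDerivAt x) (hne x hx)).add
      (((hasDerivAt_inv hx0).const_mul _).sub_const _)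
  · intro x hx
    have hx0 : 0 < x := ha.trans_le hx.1
    have hpx := hne x hx
    have hode := congrArg (Polynomial.eval x) (kummerPoly_ode hα m)
    simp only [Polynomial.eval_mul, Polynomial.eval_sub, Polynomial.eval_add, Polynomial.eval_C,
      Polynomial.eval_X, Polynomial.eval_zero, ← hp] at hode
    have h2 : p.derivative.derivative.eval x
        = -((α + 1 - x) * p.derivative.eval x + m * p.eval x) / x := by
      field_simp
      linear_combination hode
    have key := hQ x hx
    rw [h2]
    have : c ^ 2 ≤ (4 * m * x - (α + 1 - x) ^ 2 + 2 * (α + 1)) / (4 * x ^ 2) := by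
      rw [le_div_iff₀ (by positivity)]
      linarith
    refine le_of_eq_of_le ?_ (neg_le_neg (add_le_add_right this _))
    field_simp
    ring

lemma hermiteH_eq_zero_iff {n : ℕ} {γ x : ℝ} (hγ : -(1 / 2) < γ) (hx : x ≠ 0) :
    hermiteH n γ x = 0 ↔ (kummerPoly (γ - 1 / 2) (n / 2)).eval (x ^ 2) = 0 := by
  rw [← laguerreL_eq_zero_iff (by linarith)]
  have hf : ((n / 2).factorial : ℝ) ≠ 0 := by positivity
  unfold hermiteH
  split_ifs <;> simp [hx, hf]

lemma abs_kummerPoly_root_sub_le {n : ℕ} {γ ε y : ℝ} (hn : 1 ≤ n) (hε : 0 < ε)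
    (hγ : 1 / 2 < γ) (hnγ : n ≤ ε ^ 2 * γ)
    (hy : (kummerPoly (γ - 1 / 2) (n / 2)).eval y = 0) :
    |y - γ| ≤ (√2 + 2 * ε) * √(n * γ) := by
  set S := √(n * γ) with hS
  set m := n / 2 with hm
  have hn' : (1 : ℝ) ≤ n := by exact_mod_cast hn
  have hS2 : S ^ 2 = n * γ := Real.sq_sqrt (by positivity)
  have hS0 : 0 ≤ S := Real.sqrt_nonneg _
  have hnS : n ≤ ε * S := by
    refine abs_le_of_sq_le_sq' ?_ (by positivity) |>.2
    rw [mul_pow, hS2]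
    nlinarith
  have hmn : 2 * (m : ℝ) ≤ n := by
    have : 2 * m ≤ n := by omega
    exact_mod_cast this
  rcases Nat.eq_zero_or_pos m with h0 | hm0
  · simp [h0, kummerPoly, risingProd] at hy
  have hm1 : (1 : ℝ) ≤ m := by exact_mod_cast hm0
  set R := √(m * (m + (γ - 1 / 2))) with hR
  have hRpos : 0 < R := Real.sqrt_pos.mpr (by nlinarith)
  have hR2 : R ^ 2 = m * (m + (γ - 1 / 2)) := Real.sq_sqrt (by nlinarith)
  have h2 : √2 ^ 2 = 2 := Real.sq_sqrt (by norm_num)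
  have h20 : 0 ≤ √2 := Real.sqrt_nonneg 2
  have hRle : 2 * R ≤ n + √2 * S := by
    refine abs_le_of_sq_le_sq' ?_ (by positivity) |>.2
    have e1 : 0 ≤ n * (√2 * S) := by positivity
    have e2 : (m : ℝ) * (m + (γ - 1 / 2)) ≤ n / 2 * (n / 2 + γ) := by
      apply mul_le_mul <;> nlinarith
    calc (2 * R) ^ 2 = 4 * (m * (m + (γ - 1 / 2))) := by rw [mul_pow, hR2]; norm_num
      _ ≤ 4 * (n / 2 * (n / 2 + γ)) := by linarith
      _ = n ^ 2 + √2 ^ 2 * S ^ 2 := by rw [h2, hS2]; ring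
      _ ≤ (n + √2 * S) ^ 2 := by nlinarith
  have hRm : ∀ k : ℕ, k < m → (k : ℝ) * (k + (γ - 1 / 2)) ≤ R ^ 2 := by
    intro k hk
    have : (k : ℝ) ≤ m := by exact_mod_cast hk.le
    have hk_nonneg : (0 : ℝ) ≤ k := k.cast_nonneg
    rw [hR2]
    apply mul_le_mul <;> linarith
  rw [abs_le]
  constructor
  · by_contra! hlt
    refine kummerPoly_eval_ne_zero (σ := 1) (by linarith) hRpos m (by norm_num) hRm ?_ hy
    intro k _
    have hk_nonneg : (0 : ℝ) ≤ k := k.cast_nonneg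
    nlinarith
  · by_contra! hlt
    refine kummerPoly_eval_ne_zero (σ := -1) (by linarith) hRpos m (by norm_num) hRm ?_ hy
    intro k hk
    have : (k : ℝ) + 1 ≤ m := by exact_mod_cast hk
    nlinarith

lemma exists_kummerPoly_root_scaled {n : ℕ} {γ ε r s t : ℝ} (hn : 1 ≤ n) (hε : 0 < ε)
    (hε4 : ε ≤ 1 / 4) (hεr : 8 * ε ≤ 2 - r ^ 2) (hnγ : n ≤ ε ^ 2 * γ)
    (hrs : -r ≤ s) (hst : s < t) (htr : t ≤ r)
    (hlen : Real.pi ≤ √((2 - r ^ 2) / 64) * (t - s) * n) :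
    ∃ y, 0 < y ∧ (y - γ) / √(n * γ) ∈ Set.Icc s t ∧
      (kummerPoly (γ - 1 / 2) (n / 2)).eval y = 0 := by
  have hn' : (1 : ℝ) ≤ n := by exact_mod_cast hn
  have hγ : 0 < γ := pos_of_mul_pos_right (by linarith) (sq_nonneg ε)
  set S := √(n * γ) with hS
  have hSpos : 0 < S := Real.sqrt_pos.mpr (by positivity)
  have hS2 : S ^ 2 = n * γ := Real.sq_sqrt (by positivity)
  have hnS : n ≤ ε * S := by
    refine abs_le_of_sq_le_sq' ?_ (by positivity) |>.2
    rw [mul_pow, hS2]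
    nlinarith
  have hSγ : S ≤ ε * γ := by
    refine abs_le_of_sq_le_sq' ?_ (by positivity) |>.2
    rw [mul_pow, hS2]
    nlinarith
  set κ := (2 - r ^ 2) / 64 with hκ
  have hκ0 : 0 < κ := by rw [hκ]; linarith
  have hr2 : r ≤ 2 := by nlinarith
  have hpos : ∀ u, s ≤ u → 0 < γ + u * S := by
    intro u hu
    nlinarith
  have hcS : √κ * S / γ * S = √κ * n := by
    field_simp
    rw [hS2, mul_comm]
  obtain ⟨y, hy, h0⟩ := exists_kummerPoly_eval_eq_zero (α := γ - 1 / 2) (a := γ + s * S)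
    (b := γ + t * S) (c := √κ * S / γ) (by linarith) (n / 2) (hpos s le_rfl)
    (by nlinarith) (by positivity)
    (by
      calc Real.pi ≤ √κ * (t - s) * n := hlen
        _ = (√κ * n) * (t - s) := by ring
        _ = √κ * S / γ * (γ + t * S - (γ + s * S)) := by rw [← hcS]; ring)
    (by
      intro x hx
      obtain ⟨u, rfl⟩ : ∃ u, x = γ + u * S := ⟨(x - γ) / S, by field_simp; ring⟩
      have hsu : s ≤ u := le_of_mul_le_mul_right (by linarith [hx.1]) hSpos
      have hut : u ≤ t := le_of_mul_le_mul_right (by linarith [hx.2]) hSpos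
      have hx0 := hpos u hsu
      have hm : (n : ℝ) - 1 ≤ 2 * (n / 2 : ℕ) := by
        have : n ≤ 2 * (n / 2) + 1 := by omega
        have : (n : ℝ) ≤ 2 * (n / 2 : ℕ) + 1 := by exact_mod_cast this
        linarith
      have hx2 : γ + u * S ≤ 2 * γ := by nlinarith
      have hu2 : u ^ 2 ≤ r ^ 2 := sq_le_sq' (by linarith) (by linarith)
      have e1 : 4 * (√κ * S / γ) ^ 2 * (γ + u * S) ^ 2 ≤ 16 * κ * S ^ 2 := by
        rw [div_pow, mul_pow, Real.sq_sqrt hκ0.le]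
        have : (γ + u * S) ^ 2 ≤ (2 * γ) ^ 2 := pow_le_pow_left₀ hx0.le hx2 2
        calc 4 * (κ * S ^ 2 / γ ^ 2) * (γ + u * S) ^ 2
            ≤ 4 * (κ * S ^ 2 / γ ^ 2) * (2 * γ) ^ 2 := by gcongr
          _ = 16 * κ * S ^ 2 := by field_simp; norm_num
      have e2 : 2 * ((n : ℝ) - 1) * (γ + u * S) ≤ 4 * (n / 2 : ℕ) * (γ + u * S) := by
        have := mul_le_mul_of_nonneg_right hm hx0.le
        linarith
      have hu0 : -2 ≤ u := by linarith
      have hu1 : u ≤ 2 := by linarith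
      have e3 : -4 * n * S ≤ 2 * n * u * S := by
        have : 0 ≤ (n : ℝ) * S := by positivity
        nlinarith
      have e4 : u * S ≤ 2 * S := by nlinarith
      have e5 : n * S ≤ ε * S ^ 2 := by
        have := mul_le_mul_of_nonneg_right hnS hSpos.le
        linarith
      have e6 : S ≤ ε * S ^ 2 := by
        have := mul_le_mul_of_nonneg_right hn' hSpos.le
        linarith
      have e7 : (2 - r ^ 2) * S ^ 2 ≤ (2 - u ^ 2) * S ^ 2 := by
        exact mul_le_mul_of_nonneg_right (by linarith) (sq_nonneg S)
      have e8 : 8 * ε * S ^ 2 ≤ (2 - r ^ 2) * S ^ 2 :=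
        mul_le_mul_of_nonneg_right hεr (sq_nonneg S)
      have e9 : 16 * κ * S ^ 2 = (2 - r ^ 2) * S ^ 2 / 4 := by rw [hκ]; ring
      have e10 : 2 * ((n : ℝ) - 1) * (γ + u * S) = 2 * S ^ 2 + 2 * n * u * S - 2 * γ
          - 2 * (u * S) := by rw [hS2]; ring
      have e11 : (γ - 1 / 2 + 1 - (γ + u * S)) ^ 2 = 1 / 4 - u * S + u ^ 2 * S ^ 2 := by ring
      rw [e11]
      linarith)
  refine ⟨y, (hpos s le_rfl).trans_le hy.1, ⟨?_, ?_⟩, h0⟩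
  · rw [le_div_iff₀ hSpos]
    linarith [hy.1]
  · rw [div_le_iff₀ hSpos]
    linarith [hy.2]

lemma eventually_le_mul_of_tendsto_div {γ : ℕ → ℝ}
    (hγlim : Tendsto (fun n : ℕ => γ n / n) atTop atTop) {c : ℝ} (hc : 0 < c) :
    ∀ᶠ n : ℕ in atTop, (n : ℝ) ≤ c * γ n := by
  filter_upwards [hγlim.eventually_ge_atTop (1 / c), eventually_gt_atTop 0] with n h hn
  have hn' : (0 : ℝ) < n := by exact_mod_cast hn
  rw [div_le_div_iff₀ hc hn'] at h
  linarith

lemma eventually_abs_hermiteH_root_le {γ : ℕ → ℝ} (hγ : ∀ n, γ n > -(1 / 2))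
    (hγlim : Tendsto (fun n : ℕ => γ n / n) atTop atTop) {ε : ℝ} (hε : 0 < ε) :
    ∀ᶠ n : ℕ in atTop, ∀ x : ℝ, x ≠ 0 → hermiteH n (γ n) x = 0 →
      |(x ^ 2 - γ n) / √(n * γ n)| ≤ √2 + ε := by
  filter_upwards [eventually_le_mul_of_tendsto_div hγlim (c := (ε / 2) ^ 2) (by positivity),
    eventually_le_mul_of_tendsto_div hγlim one_pos, eventually_ge_atTop 1] with n h1 h2 hn x hx hH
  have hn' : (1 : ℝ) ≤ n := by exact_mod_cast hn
  have hγ1 : 1 ≤ γ n := by linarith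
  rw [hermiteH_eq_zero_iff (hγ n) hx] at hH
  have hS : 0 < √(n * γ n) := Real.sqrt_pos.mpr (by positivity)
  rw [abs_div, abs_of_pos hS, div_le_iff₀ hS]
  have := abs_kummerPoly_root_sub_le hn (half_pos hε) (by linarith) h1 hH
  rwa [mul_div_cancel₀ ε two_ne_zero] at this

lemma eventually_exists_hermiteH_root {γ : ℕ → ℝ} (hγ : ∀ n, γ n > -(1 / 2))
    (hγlim : Tendsto (fun n : ℕ => γ n / n) atTop atTop) {s t : ℝ} (hs : -√2 < s) (hst : s < t)
    (ht : t < √2) :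
    ∀ᶠ n : ℕ in atTop, ∃ x : ℝ, 0 < x ∧ hermiteH n (γ n) x = 0 ∧ hermiteH n (γ n) (-x) = 0 ∧
      (x ^ 2 - γ n) / √(n * γ n) ∈ Set.Icc s t := by
  set r := max (-s) t with hr
  have hr2 : r < √2 := max_lt (by linarith) ht
  have hsr : -s ≤ r := le_max_left _ _
  have htr : t ≤ r := le_max_right _ _
  have hδ : 0 < 2 - r ^ 2 := by
    have h2 : √2 ^ 2 = 2 := Real.sq_sqrt (by norm_num)
    nlinarith
  set ε := min (1 / 4) ((2 - r ^ 2) / 8) with hεdef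
  have hε : 0 < ε := lt_min (by norm_num) (by linarith)
  have hK : 0 < √((2 - r ^ 2) / 64) * (t - s) :=
    mul_pos (Real.sqrt_pos.mpr (by linarith)) (by linarith)
  filter_upwards [eventually_le_mul_of_tendsto_div hγlim (c := ε ^ 2) (by positivity),
    (tendsto_natCast_atTop_atTop (R := ℝ)).eventually_ge_atTop
      (Real.pi / (√((2 - r ^ 2) / 64) * (t - s))), eventually_ge_atTop 1] with n h1 h2 hn
  rw [div_le_iff₀' hK] at h2
  obtain ⟨y, hy, hmem, h0⟩ := exists_kummerPoly_root_scaled hn hε (min_le_left _ _)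
    (by linarith [min_le_right (1 / 4) ((2 - r ^ 2) / 8)]) h1 (by linarith) hst htr h2
  have hx := Real.sqrt_pos.mpr hy
  have hsq := Real.sq_sqrt hy.le
  refine ⟨√y, hx, ?_, ?_, by rwa [hsq]⟩
  · rwa [hermiteH_eq_zero_iff (hγ n) hx.ne', hsq]
  · rwa [hermiteH_eq_zero_iff (hγ n) (neg_ne_zero.mpr hx.ne'), neg_sq, hsq]

lemma tendsto_sqrt_two_of_eventually_bounds {f : ℕ → ℝ}
    (hle : ∀ ε > 0, ∀ᶠ n in atTop, f n ≤ √2 + ε)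
    (hge : ∀ s t, -√2 < s → s < t → t < √2 → ∀ᶠ n in atTop, s ≤ f n) :
    Tendsto f atTop (𝓝 (√2)) := by
  have h2 : 0 < √2 := Real.sqrt_pos.mpr two_pos
  refine tendsto_order.mpr ⟨fun a ha => ?_, fun a ha => ?_⟩
  · obtain ⟨s, hs, hs2⟩ := exists_between (max_lt ha (by linarith : -√2 < √2))
    obtain ⟨t, hst, ht⟩ := exists_between hs2
    filter_upwards [hge s t ((le_max_right _ _).trans_lt hs) hst ht] with n hn
    exact ((le_max_left _ _).trans_lt hs).trans_le hn
  · filter_upwards [hle ((a - √2) / 2) (by linarith)] with n hn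
    linarith

theorem stmt16 (γ : ℕ → ℝ)
    (hγ : ∀ n, γ n > -(1/2))
    (hγlim : Tendsto (fun n : ℕ => γ n / n) atTop atTop)
    (σp ρp σm ρm : ℕ → ℝ)
    (hσp : ∀ n : ℕ, 2 ≤ n →
      IsGreatest {x : ℝ | hermiteH n (γ n) x = 0 ∧ 0 < x} (σp n))
    (hρp : ∀ n : ℕ, 2 ≤ n →
      IsLeast {x : ℝ | hermiteH n (γ n) x = 0 ∧ 0 < x} (ρp n))
    (hσm : ∀ n : ℕ, 2 ≤ n →
      IsGreatest {x : ℝ | hermiteH n (γ n) x = 0 ∧ x < 0} (σm n))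
    (hρm : ∀ n : ℕ, 2 ≤ n →
      IsLeast {x : ℝ | hermiteH n (γ n) x = 0 ∧ x < 0} (ρm n)) :
    Tendsto (fun n : ℕ => ((σp n) ^ 2 - γ n) / Real.sqrt ((n : ℝ) * γ n))
      atTop (𝓝 (Real.sqrt 2)) ∧
    Tendsto (fun n : ℕ => ((ρm n) ^ 2 - γ n) / Real.sqrt ((n : ℝ) * γ n))
      atTop (𝓝 (Real.sqrt 2)) ∧
    Tendsto (fun n : ℕ => ((ρp n) ^ 2 - γ n) / Real.sqrt ((n : ℝ) * γ n))
      atTop (𝓝 (-Real.sqrt 2)) ∧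
    Tendsto (fun n : ℕ => ((σm n) ^ 2 - γ n) / Real.sqrt ((n : ℝ) * γ n))
      atTop (𝓝 (-Real.sqrt 2)) ∧
    Set.Icc (-Real.sqrt 2) (Real.sqrt 2) ⊆
      closure (⋃ n : ℕ, ⋃ _ : 1 ≤ n,
        (fun x => (x ^ 2 - γ n) / Real.sqrt ((n : ℝ) * γ n)) ''
          {x : ℝ | hermiteH n (γ n) x = 0 ∧ x ≠ 0}) := by
  have hup := fun ε (hε : 0 < ε) => eventually_abs_hermiteH_root_le hγ hγlim hε
  have hex := fun s t (hs : -√2 < s) (hst : s < t) (ht : t < √2) =>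
    eventually_exists_hermiteH_root hγ hγlim hs hst ht
  have hneg : ∀ {f : ℕ → ℝ}, (∀ ε > 0, ∀ᶠ n in atTop, -f n ≤ √2 + ε) →
      (∀ s t, -√2 < s → s < t → t < √2 → ∀ᶠ n in atTop, f n ≤ t) →
      Tendsto f atTop (𝓝 (-√2)) := by
    intro f h1 h2
    have := (tendsto_sqrt_two_of_eventually_bounds (f := fun n => -f n) h1
      fun s t hs hst ht => (h2 (-t) (-s) (by linarith) (by linarith) (by linarith)).mono
        fun n hn => by linarith).neg
    simpa using this
  refine ⟨tendsto_sqrt_two_of_eventually_bounds (fun ε hε => ?_) fun s t hs hst ht => ?_,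
    tendsto_sqrt_two_of_eventually_bounds (fun ε hε => ?_) fun s t hs hst ht => ?_,
    hneg (fun ε hε => ?_) fun s t hs hst ht => ?_,
    hneg (fun ε hε => ?_) fun s t hs hst ht => ?_, ?_⟩
  · filter_upwards [hup ε hε, eventually_ge_atTop 2] with n h hn
    exact (le_abs_self _).trans (h _ (hσp n hn).1.2.ne' (hσp n hn).1.1)
  · filter_upwards [hex s t hs hst ht, eventually_ge_atTop 2] with n ⟨x, hx, h1, h2, h3⟩ hn
    have hle : x ≤ σp n := (hσp n hn).2 ⟨h1, hx⟩
    refine h3.1.trans ?_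
    gcongr
  · filter_upwards [hup ε hε, eventually_ge_atTop 2] with n h hn
    exact (le_abs_self _).trans (h _ (hρm n hn).1.2.ne (hρm n hn).1.1)
  · filter_upwards [hex s t hs hst ht, eventually_ge_atTop 2] with n ⟨x, hx, h1, h2, h3⟩ hn
    have hle : ρm n ≤ -x := (hρm n hn).2 ⟨h2, neg_lt_zero.mpr hx⟩
    have hsq : x ^ 2 ≤ ρm n ^ 2 := by nlinarith
    refine h3.1.trans ?_
    gcongr
  · filter_upwards [hup ε hε, eventually_ge_atTop 2] with n h hn
    exact (neg_le_abs _).trans (h _ (hρp n hn).1.2.ne' (hρp n hn).1.1)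
  · filter_upwards [hex s t hs hst ht, eventually_ge_atTop 2] with n ⟨x, hx, h1, h2, h3⟩ hn
    have hle : ρp n ≤ x := (hρp n hn).2 ⟨h1, hx⟩
    have hpos : 0 < ρp n := (hρp n hn).1.2
    refine le_trans ?_ h3.2
    gcongr
  · filter_upwards [hup ε hε, eventually_ge_atTop 2] with n h hn
    exact (neg_le_abs _).trans (h _ (hσm n hn).1.2.ne (hσm n hn).1.1)
  · filter_upwards [hex s t hs hst ht, eventually_ge_atTop 2] with n ⟨x, hx, h1, h2, h3⟩ hn
    have hle : -x ≤ σm n := (hσm n hn).2 ⟨h2, neg_lt_zero.mpr hx⟩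
    have hneg : σm n < 0 := (hσm n hn).1.2
    have hsq : σm n ^ 2 ≤ x ^ 2 := by nlinarith
    refine le_trans ?_ h3.2
    gcongr
  · have h2 : 0 < √2 := Real.sqrt_pos.mpr two_pos
    rw [← closure_Ioo (by linarith : -√2 ≠ √2)]
    refine closure_minimal (fun u hu => ?_) isClosed_closure
    rw [Metric.mem_closure_iff]
    intro ε hε
    obtain ⟨t, hut, ht⟩ := exists_between (lt_min hu.2 (by linarith : u < u + ε))
    obtain ⟨n, ⟨x, hx, h1, -, h3⟩, hn⟩ :=
      ((hex u t hu.1 hut (ht.trans_le (min_le_left _ _))).and (eventually_ge_atTop 1)).exists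
    refine ⟨_, Set.mem_iUnion₂.mpr ⟨n, hn, x, ⟨h1, hx.ne'⟩, rfl⟩, ?_⟩
    have := ht.trans_le (min_le_right _ _)
    rw [Real.dist_eq, abs_lt]
    constructor <;> linarith [h3.1, h3.2]
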